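/- arXiv:2206.12691 — 2 statements merged into one kernel-verified Lean document; each statement's English description precedes it below -/
import Mathlib

section
/- Let α₁, α₂, α₃, α₄ ∈ (0, π) be the sector angles of a degree-4 rigid origami vertex and let (ρ₁, ρ₂, ρ₃, ρ₄) satisfy the rotation-matrix closure condition. Then for each i ∈ {1,2,3,4} (indices modulo 4) with ρ_i, ρ_{i+1} ∈ (−π, π), the adjacent folding angles satisfy cos α_{i+2} · (1 + tan²(ρ_i/2)) · (1 + tan²(ρ_{i+1}/2)) = cos(α_{i+1}−α_i−α_{i−1})·tan²(ρ_{i+1}/2) + cos(α_{i+1}+α_i−α_{i−1})·tan²(ρ_i/2) + cos(α_{i+1}−α_i+α_{i−1})·tan²(ρ_i/2)·tan²(ρ_{i+1}/2) + cos(α_{i+1}+α_i+α_{i−1}) + 4·sin α_{i+1} · sin α_{i−1} · tan(ρ_i/2)·tan(ρ_{i+1}/2). -/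
open Real Matrix

/-- Rotation of ℝ³ by angle `β` about the x-axis. -/
noncomputable def Rx (β : ℝ) : Matrix (Fin 3) (Fin 3) ℝ :=
  !![1, 0, 0;
     0, Real.cos β, -Real.sin β;
     0, Real.sin β, Real.cos β]

/-- Rotation of ℝ³ by angle `β` about the z-axis. -/
noncomputable def Rz (β : ℝ) : Matrix (Fin 3) (Fin 3) ℝ :=
  !![Real.cos β, -Real.sin β, 0;
     Real.sin β, Real.cos β, 0;
     0, 0, 1]

/-- The spherical-linkage loop (closure) condition for a degree-4 origami vertex with
sector angles `α₁, α₂, α₃, α₄` and folding angles `ρ₁, ρ₂, ρ₃, ρ₄`. -/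
def ClosureCond (α₁ α₂ α₃ α₄ ρ₁ ρ₂ ρ₃ ρ₄ : ℝ) : Prop :=
  Rx ρ₁ * Rz α₁ * Rx ρ₂ * Rz α₂ * Rx ρ₃ * Rz α₃ * Rx ρ₄ * Rz α₄ = 1

/-- Closure condition, `Fin 4`-indexed version (index `j` ↔ paper index `j+1`). -/
def ClosureCondF (α ρ : Fin 4 → ℝ) : Prop :=
  ClosureCond (α 0) (α 1) (α 2) (α 3) (ρ 0) (ρ 1) (ρ 2) (ρ 3)

lemma Rx_inv (b : ℝ) : Rx b * Rx (-b) = 1 := by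
  have h := Real.sin_sq_add_cos_sq b
  ext i j
  fin_cases i <;> fin_cases j <;> simp [Rx, Matrix.mul_apply, Fin.sum_univ_three] <;> linarith

lemma Rz_inv (b : ℝ) : Rz b * Rz (-b) = 1 := by
  have h := Real.sin_sq_add_cos_sq b
  ext i j
  fin_cases i <;> fin_cases j <;> simp [Rz, Matrix.mul_apply, Fin.sum_univ_three] <;> linarith

lemma closure_rot {a b c d p q r s : ℝ} (h : ClosureCond a b c d p q r s) :
    ClosureCond b c d a q r s p := by
  unfold ClosureCond at *
  have h2 : (Rx p * Rz a) * (Rx q * Rz b * Rx r * Rz c * Rx s * Rz d) = 1 := by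
    rw [← h]; simp only [Matrix.mul_assoc]
  rw [mul_eq_one_comm] at h2
  rw [← h2]; simp only [Matrix.mul_assoc]

lemma half_tan {x : ℝ} (hx : x ∈ Set.Ioo (-π) π) :
    Real.cos x * (1 + Real.tan (x / 2) ^ 2) = 1 - Real.tan (x / 2) ^ 2 ∧
    Real.sin x * (1 + Real.tan (x / 2) ^ 2) = 2 * Real.tan (x / 2) := by
  have hc : Real.cos (x / 2) ≠ 0 :=
    (Real.cos_pos_of_mem_Ioo ⟨by linarith [hx.1], by linarith [hx.2]⟩).ne'
  have h1 : Real.cos x = 2 * Real.cos (x / 2) ^ 2 - 1 := by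
    rw [← Real.cos_two_mul]; congr 1; ring
  have h2 : Real.sin x = 2 * Real.sin (x / 2) * Real.cos (x / 2) := by
    rw [← Real.sin_two_mul]; congr 1; ring
  have h := Real.sin_sq_add_cos_sq (x / 2)
  have h3 : (1 + Real.tan (x / 2) ^ 2) * Real.cos (x / 2) ^ 2 = 1 := by
    rw [Real.tan_eq_sin_div_cos]; field_simp; linarith
  have h4 : Real.sin (x / 2) = Real.tan (x / 2) * Real.cos (x / 2) :=
    (Real.tan_mul_cos hc).symm
  rw [h1, h2, h4]
  constructor
  · linear_combination 2 * h3
  · linear_combination 2 * Real.tan (x / 2) * h3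

lemma key {a b c d p q r s : ℝ} (h : ClosureCond a b c d p q r s)
    (hp : p ∈ Set.Ioo (-π) π) (hq : q ∈ Set.Ioo (-π) π) :
    Real.cos c * (1 + Real.tan (p / 2) ^ 2) * (1 + Real.tan (q / 2) ^ 2)
        = Real.cos (b - a - d) * Real.tan (q / 2) ^ 2
          + Real.cos (b + a - d) * Real.tan (p / 2) ^ 2
          + Real.cos (b - a + d) * Real.tan (p / 2) ^ 2 * Real.tan (q / 2) ^ 2
          + Real.cos (b + a + d)
          + 4 * Real.sin b * Real.sin d * Real.tan (p / 2) * Real.tan (q / 2) := by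
  unfold ClosureCond at h
  have h1 : (Rx p * Rz a * Rx q * Rz b * Rx r * Rz c * Rx s) * Rz d = 1 := h
  rw [mul_eq_one_comm] at h1
  have h2 : (Rz d * (Rx p * Rz a * Rx q) * Rz b) * (Rx r * Rz c * Rx s) = 1 := by
    rw [← h1]; simp only [Matrix.mul_assoc]
  have h3 : (Rx r * Rz c * Rx s) * (Rx (-s) * Rz (-c) * Rx (-r)) = 1 := by
    calc _ = Rx r * (Rz c * (Rx s * Rx (-s)) * Rz (-c)) * Rx (-r) := by
          simp only [Matrix.mul_assoc]
      _ = 1 := by rw [Rx_inv, Matrix.mul_one, Rz_inv, Matrix.mul_one, Rx_inv]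
  have h4 := left_inv_eq_right_inv h2 h3
  have h5 := congrFun (congrFun h4 0) 0
  simp [Rx, Rz, Matrix.mul_apply, Fin.sum_univ_three] at h5
  obtain ⟨p1, p2⟩ := half_tan hp
  obtain ⟨q1, q2⟩ := half_tan hq
  simp only [Real.cos_add, Real.cos_sub, Real.sin_add, Real.sin_sub]
  generalize Real.tan (p / 2) = t at *
  generalize Real.tan (q / 2) = u at *
  have e : Real.cos c = Real.cos d * (Real.cos a * Real.cos b - Real.sin a * Real.cos q * Real.sin b)
      - Real.sin d * (Real.cos p * Real.sin a * Real.cos b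
        + Real.sin b * (Real.cos p * Real.cos a * Real.cos q - Real.sin p * Real.sin q)) := by
    linarith
  rw [e]
  linear_combination
    (-Real.cos d * Real.sin a * Real.sin b * (1 + t ^ 2)) * q1
    - Real.sin d * Real.sin a * Real.cos b * (1 + u ^ 2) * p1
    - Real.sin d * Real.sin b * Real.cos a * (Real.cos q * (1 + u ^ 2) * p1 + (1 - t ^ 2) * q1)
    + Real.sin d * Real.sin b * (Real.sin q * (1 + u ^ 2) * p2 + 2 * t * q2)


/-- Theorem 2, Eq. (5): adjacent-folding-angle relation for a general degree-4
rigid origami vertex. -/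
theorem adjacent_folding_angle_relation (α ρ : Fin 4 → ℝ)
    (hα : ∀ j, α j ∈ Set.Ioo 0 π)
    (hclose : ClosureCondF α ρ) :
    ∀ i : Fin 4, ρ i ∈ Set.Ioo (-π) π → ρ (i + 1) ∈ Set.Ioo (-π) π →
      Real.cos (α (i + 2)) * (1 + Real.tan (ρ i / 2) ^ 2) * (1 + Real.tan (ρ (i + 1) / 2) ^ 2)
        = Real.cos (α (i + 1) - α i - α (i + 3)) * Real.tan (ρ (i + 1) / 2) ^ 2
          + Real.cos (α (i + 1) + α i - α (i + 3)) * Real.tan (ρ i / 2) ^ 2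
          + Real.cos (α (i + 1) - α i + α (i + 3)) * Real.tan (ρ i / 2) ^ 2 * Real.tan (ρ (i + 1) / 2) ^ 2
          + Real.cos (α (i + 1) + α i + α (i + 3))
          + 4 * Real.sin (α (i + 1)) * Real.sin (α (i + 3)) * Real.tan (ρ i / 2) * Real.tan (ρ (i + 1) / 2) := by
  intro i hi hj
  have h0 : ClosureCond (α 0) (α 1) (α 2) (α 3) (ρ 0) (ρ 1) (ρ 2) (ρ 3) := hclose
  have h1 := closure_rot h0
  have h2 := closure_rot h1
  have h3 := closure_rot h2
  fin_cases i
  · exact key h0 hi hj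
  · exact key h1 hi hj
  · exact key h2 hi hj
  · exact key h3 hi hj
end

section
/- Let α₁, α₂, α₃, α₄ ∈ (0, π) satisfy α₁+α₂+α₃+α₄ = 2π and α₁−α₂+α₃−α₄ = 0 (a developable, flat-foldable degree-4 vertex), labeled so that α₁ ≤ α₂, α₂ < α₃ and α₂ < α₄. Suppose ρ₁, ρ₂ ∈ (−π, π) satisfy the mode-2 relation sin((α₁+α₂)/2)·tan(ρ₁/2) = sin((α₁−α₂)/2)·tan(ρ₂/2). Then the tuple (ρ₁, ρ₂, ρ₃, ρ₄) with ρ₃ = −ρ₁ and ρ₄ = ρ₂ satisfies the rotation-matrix closure condition; that is, the mode-2 curve lies in the configuration space of the vertex. -/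
open Real Matrix

def Qm (w x y z : ℝ) : Matrix (Fin 3) (Fin 3) ℝ :=
  !![w^2+x^2-y^2-z^2, 2*(x*y-w*z), 2*(x*z+w*y);
     2*(x*y+w*z), w^2-x^2+y^2-z^2, 2*(y*z-w*x);
     2*(x*z-w*y), 2*(y*z+w*x), w^2-x^2-y^2+z^2]

lemma Qm_mul (a b c d w x y z : ℝ) : Qm a b c d * Qm w x y z =
    Qm (a*w-b*x-c*y-d*z) (a*x+b*w+c*z-d*y) (a*y-b*z+c*w+d*x) (a*z+b*y-c*x+d*w) := by
  ext i j
  fin_cases i <;> fin_cases j <;> simp [Qm, Matrix.mul_apply, Fin.sum_univ_three] <;> ring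

lemma cos_half (β : ℝ) : cos β = cos (β/2)^2 - sin (β/2)^2 := by
  rw [← Real.cos_two_mul']; congr 1; ring

lemma sin_half (β : ℝ) : sin β = 2 * sin (β/2) * cos (β/2) := by
  rw [← Real.sin_two_mul]; congr 1; ring

lemma Rx_Qm (β : ℝ) : Rx β = Qm (cos (β/2)) (sin (β/2)) 0 0 := by
  have h := Real.sin_sq_add_cos_sq (β/2)
  have h1 := cos_half β
  have h2 := sin_half β
  ext i j
  fin_cases i <;> fin_cases j <;> simp [Qm, Rx] <;> linarith

lemma Rz_Qm (β : ℝ) : Rz β = Qm (cos (β/2)) 0 0 (sin (β/2)) := by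
  have h := Real.sin_sq_add_cos_sq (β/2)
  have h1 := cos_half β
  have h2 := sin_half β
  ext i j
  fin_cases i <;> fin_cases j <;> simp [Qm, Rz] <;> linarith

lemma Rx_neg_right (β : ℝ) : Rx β * Rx (-β) = 1 := by
  have h := Real.sin_sq_add_cos_sq β
  ext i j
  fin_cases i <;> fin_cases j <;>
    simp [Rx, Matrix.mul_apply, Fin.sum_univ_three] <;> linarith

lemma Rz_neg_right (β : ℝ) : Rz β * Rz (-β) = 1 := by
  have h := Real.sin_sq_add_cos_sq β
  ext i j
  fin_cases i <;> fin_cases j <;>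
    simp [Rz, Matrix.mul_apply, Fin.sum_univ_three] <;> linarith

lemma Rz_pi (a b r : ℝ) : Rz (π - a) * Rx r * Rz (π - b) = Rz (-a) * Rx (-r) * Rz (-b) := by
  ext i j
  fin_cases i <;> fin_cases j <;>
    simp [Rz, Rx, Matrix.mul_apply, Fin.sum_univ_three] <;> ring

lemma comm_lemma (a b r t : ℝ)
    (h : sin ((a+b)/2) * sin (r/2) * cos (t/2) = sin ((a-b)/2) * sin (t/2) * cos (r/2)) :
    Rx r * (Rz a * Rx t * Rz b) = (Rz b * Rx t * Rz a) * Rx r := by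
  have e1 : (a+b)/2 = a/2 + b/2 := by ring
  have e2 : (a-b)/2 = a/2 - b/2 := by ring
  rw [e1, e2, Real.sin_add, Real.sin_sub] at h
  simp only [Rx_Qm, Rz_Qm, Qm_mul]
  congr 1
  · ring
  · ring
  · linear_combination (-2) * h
  · ring

/-- The mode-2 curve of a developable, flat-foldable degree-4 vertex lies in its
configuration space. -/
theorem mode2_in_config_space (α₁ α₂ α₃ α₄ ρ₁ ρ₂ : ℝ)
    (hα₁ : α₁ ∈ Set.Ioo 0 π) (hα₂ : α₂ ∈ Set.Ioo 0 π)
    (hα₃ : α₃ ∈ Set.Ioo 0 π) (hα₄ : α₄ ∈ Set.Ioo 0 π)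
    (hdev : α₁ + α₂ + α₃ + α₄ = 2 * π)
    (hff : α₁ - α₂ + α₃ - α₄ = 0)
    (h12 : α₁ ≤ α₂) (h23 : α₂ < α₃) (h24 : α₂ < α₄)
    (hρ₁ : ρ₁ ∈ Set.Ioo (-π) π) (hρ₂ : ρ₂ ∈ Set.Ioo (-π) π)
    (hmode2 : Real.sin ((α₁ + α₂) / 2) * Real.tan (ρ₁ / 2)
      = Real.sin ((α₁ - α₂) / 2) * Real.tan (ρ₂ / 2)) :
    ClosureCond α₁ α₂ α₃ α₄ ρ₁ ρ₂ (-ρ₁) ρ₂ := by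
  have e3 : α₃ = π - α₁ := by linarith
  have e4 : α₄ = π - α₂ := by linarith
  have c1 : cos (ρ₁/2) ≠ 0 := (Real.cos_pos_of_mem_Ioo ⟨by linarith [hρ₁.1], by linarith [hρ₁.2]⟩).ne'
  have c2 : cos (ρ₂/2) ≠ 0 := (Real.cos_pos_of_mem_Ioo ⟨by linarith [hρ₂.1], by linarith [hρ₂.2]⟩).ne'
  rw [Real.tan_eq_sin_div_cos, Real.tan_eq_sin_div_cos] at hmode2
  have h := comm_lemma α₁ α₂ ρ₁ ρ₂ (by field_simp at hmode2; linarith)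
  unfold ClosureCond
  subst e3 e4
  calc _ = (Rx ρ₁ * (Rz α₁ * Rx ρ₂ * Rz α₂)) * Rx (-ρ₁) *
        (Rz (π - α₁) * Rx ρ₂ * Rz (π - α₂)) := by simp only [Matrix.mul_assoc]
    _ = Rz α₂ * (Rx ρ₂ * (Rz α₁ * (Rx ρ₁ * Rx (-ρ₁)) * Rz (-α₁)) * Rx (-ρ₂)) * Rz (-α₂) := by
        rw [h, Rz_pi]; simp only [Matrix.mul_assoc]
    _ = 1 := by
        simp only [Rx_neg_right, Rz_neg_right, Matrix.mul_one]
end
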